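/- Let (Z,ρ) be a σ-dense K-quasi-metric space (σ > 1). Then for any three pairwise distinct points a, c, d in Z there exists a point x ∈ Z, distinct from a and d, such that 1/(2σ²) ≤ r(a,x,c,d) ≤ 1/(2σ). -/

import Mathlib

open Filter Topology

universe u v

/-- `ρ` is a `K`-quasi-metric on `Z`: nonnegative, vanishing exactly on the diagonal,
symmetric, and satisfying `ρ(x,z) ≤ K·max(ρ(x,y), ρ(y,z))`. -/
def IsQuasiMetric {Z : Type*} (K : ℝ) (ρ : Z → Z → ℝ) : Prop :=
  (∀ x y : Z, 0 ≤ ρ x y) ∧ (∀ x y : Z, ρ x y = 0 ↔ x = y) ∧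
    (∀ x y : Z, ρ x y = ρ y x) ∧ (∀ x y z : Z, ρ x z ≤ K * max (ρ x y) (ρ y z))

/-- `(Z,ρ)` is `μ`-uniformly perfect. -/
def UniformlyPerfectWith {Z : Type*} (ρ : Z → Z → ℝ) (μ : ℝ) : Prop :=
  ∀ x : Z, ∀ r : ℝ, 0 < r → (∃ z : Z, r ≤ ρ x z) →
    ∃ y : Z, μ * r ≤ ρ x y ∧ ρ x y < r

/-- `(Z,ρ)` is `(l₁,l₂)`-homogeneously dense. -/
def HomogeneouslyDense {Z : Type*} (ρ : Z → Z → ℝ) (l₁ l₂ : ℝ) : Prop :=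
  ∀ a b : Z, a ≠ b → ∃ x : Z, l₁ * ρ a b ≤ ρ a x ∧ ρ a x ≤ l₂ * ρ a b

/-- The cross ratio `r(a,b,c,d) = ρ(a,c)ρ(b,d)/(ρ(a,b)ρ(c,d))`. -/
noncomputable def crossRatio {Z : Type*} (ρ : Z → Z → ℝ) (a b c d : Z) : ℝ :=
  ρ a c * ρ b d / (ρ a b * ρ c d)

/-- `x : ℤ → Z` is a `σ`-chain joining `a` and `b`. -/
def IsSigmaChain {Z : Type*} (ρ : Z → Z → ℝ) (σ : ℝ) (a b : Z) (x : ℤ → Z) : Prop :=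
  (∀ i : ℤ, a ≠ x i ∧ x i ≠ b) ∧
    Filter.Tendsto (fun i : ℤ => ρ (x i) a) Filter.atBot (nhds 0) ∧
    Filter.Tendsto (fun i : ℤ => ρ (x i) b) Filter.atTop (nhds 0) ∧
    ∀ i : ℤ, |Real.log (crossRatio ρ a (x i) (x (i + 1)) b)| ≤ Real.log σ

/-- `(Z,ρ)` is `σ`-dense: any pair of distinct points is joined by a `σ`-chain. -/
def SigmaDense {Z : Type*} (ρ : Z → Z → ℝ) (σ : ℝ) : Prop :=
  ∀ a b : Z, a ≠ b → ∃ x : ℤ → Z, IsSigmaChain ρ σ a b x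

/-- `η` is an increasing self-homeomorphism of `[0,∞)`. -/
def ControlFun (η : ℝ → ℝ) : Prop :=
  η 0 = 0 ∧ StrictMonoOn η (Set.Ici 0) ∧ ContinuousOn η (Set.Ici 0) ∧
    ∀ s : ℝ, 0 ≤ s → ∃ t : ℝ, 0 ≤ t ∧ η t = s

/-- `f` is `η`-quasisymmetric. -/
def QuasiSymmetric {Z₁ Z₂ : Type*} (ρ₁ : Z₁ → Z₁ → ℝ) (ρ₂ : Z₂ → Z₂ → ℝ)
    (f : Z₁ → Z₂) (η : ℝ → ℝ) : Prop :=
  ∀ x a b : Z₁, x ≠ b → ∀ t : ℝ, 0 ≤ t → ρ₁ x a ≤ t * ρ₁ x b →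
    ρ₂ (f x) (f a) ≤ η t * ρ₂ (f x) (f b)

/-- `f` is `θ`-quasimöbius. -/
def QuasiMobius {Z₁ Z₂ : Type*} (ρ₁ : Z₁ → Z₁ → ℝ) (ρ₂ : Z₂ → Z₂ → ℝ)
    (f : Z₁ → Z₂) (θ : ℝ → ℝ) : Prop :=
  ∀ a b c d : Z₁, a ≠ b → a ≠ c → a ≠ d → b ≠ c → b ≠ d → c ≠ d →
    crossRatio ρ₂ (f a) (f b) (f c) (f d) ≤ θ (crossRatio ρ₁ a b c d)

/-- `(Z,ρ)` has no isolated points. -/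
def NoIsolatedPoints {Z : Type*} (ρ : Z → Z → ℝ) : Prop :=
  ∀ x : Z, ∀ r : ℝ, 0 < r → ∃ y : Z, y ≠ x ∧ ρ x y < r
theorem eventually_lt_mul_of_le_mul_max {ι : Type*} {l : Filter ι} {s t : ι → ℝ} {K D ε : ℝ}
    (hK : 0 < K) (hD : 0 < D) (hε : 0 < ε) (hs : Tendsto s l (𝓝 0))
    (h : ∀ i, D ≤ K * max (s i) (t i)) : ∀ᶠ i in l, s i < ε * t i := by
  have hDK : 0 < D / K := div_pos hD hK
  filter_upwards [hs.eventually_lt_const hDK, hs.eventually_lt_const (mul_pos hε hDK)]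
    with i h₁ h₂
  have hmax : D / K ≤ max (s i) (t i) := (div_le_iff₀' hK).2 (h i)
  have ht : D / K ≤ t i := (le_max_iff.1 hmax).resolve_left h₁.not_ge
  exact h₂.trans_le (mul_le_mul_of_nonneg_left ht hε.le)

theorem exists_int_lt_and_succ_le {u : ℤ → ℝ} {T : ℝ} (hbot : ∃ i, T < u i)
    (htop : ∀ᶠ i in atTop, u i ≤ T) : ∃ i, T < u i ∧ u (i + 1) ≤ T := by
  obtain ⟨i₀, hi₀⟩ := hbot
  by_contra! hstep
  obtain ⟨j, hj, hij⟩ := (htop.and (eventually_ge_atTop i₀)).exists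
  have hlt : T < u j := Int.leInduction (motive := fun j _ => T < u j) hi₀
    (fun k _ hk => hstep k hk) j hij
  exact hlt.not_ge hj

theorem IsQuasiMetric.pos {Z : Type*} {K : ℝ} {ρ : Z → Z → ℝ} (hρ : IsQuasiMetric K ρ)
    {x y : Z} (h : x ≠ y) : 0 < ρ x y :=
  (hρ.1 x y).lt_of_ne fun h0 => h ((hρ.2.1 x y).1 h0.symm)

theorem IsQuasiMetric.crossRatio_eq_div {Z : Type*} {K : ℝ} {ρ : Z → Z → ℝ}
    (hρ : IsQuasiMetric K ρ) {a c d x y : Z} (hac : a ≠ c) (hcd : c ≠ d) (hax : a ≠ x)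
    (hay : a ≠ y) (hyd : y ≠ d) :
    crossRatio ρ a x y d = crossRatio ρ a x c d / crossRatio ρ a y c d := by
  have := (hρ.pos hac).ne'
  have := (hρ.pos hcd).ne'
  have := (hρ.pos hax).ne'
  have := (hρ.pos hay).ne'
  have := (hρ.pos hyd).ne'
  unfold crossRatio
  field_simp

/-- in a `σ`-dense space, any triple `(a,c,d)` admits `x` with
`1/(2σ²) ≤ r(a,x,c,d) ≤ 1/(2σ)`. -/
theorem stmt4 {Z : Type u} (K σ : ℝ) (hK : 1 ≤ K) (hσ : 1 < σ)
    (ρ : Z → Z → ℝ) (hρ : IsQuasiMetric K ρ) (hdense : SigmaDense ρ σ)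
    (a c d : Z) (hac : a ≠ c) (had : a ≠ d) (hcd : c ≠ d) :
    ∃ x : Z, x ≠ a ∧ x ≠ d ∧
      1 / (2 * σ ^ 2) ≤ crossRatio ρ a x c d ∧ crossRatio ρ a x c d ≤ 1 / (2 * σ) := by
  obtain ⟨x, hx, hbot, htop, hlog⟩ := hdense a d had
  have hK0 : 0 < K := one_pos.trans_le hK
  have hσ0 : 0 < σ := one_pos.trans hσ
  have pac := hρ.pos hac
  have pad := hρ.pos had
  have pcd := hρ.pos hcd
  have pax : ∀ i, 0 < ρ a (x i) := fun i => hρ.pos (hx i).1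
  have pxd : ∀ i, 0 < ρ (x i) d := fun i => hρ.pos (hx i).2
  have hu : ∀ i, 0 < crossRatio ρ a (x i) c d := fun i =>
    div_pos (mul_pos pac (pxd i)) (mul_pos (pax i) pcd)
  set T : ℝ := 1 / (2 * σ) with hT
  have hT0 : 0 < T := by positivity
  have hquasi : ∀ i, ρ a d ≤ K * max (ρ (x i) a) (ρ (x i) d) := fun i => by
    rw [hρ.2.2.1 (x i) a]
    exact hρ.2.2.2 a (x i) d
  have hlarge : ∃ i, T < crossRatio ρ a (x i) c d := by
    have hε : 0 < ρ a c / (T * ρ c d) := by positivity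
    obtain ⟨i, hi⟩ := (eventually_lt_mul_of_le_mul_max hK0 pad hε hbot hquasi).exists
    refine ⟨i, ?_⟩
    rw [crossRatio, lt_div_iff₀ (mul_pos (pax i) pcd)]
    rw [hρ.2.2.1 (x i) a, div_mul_eq_mul_div, lt_div_iff₀ (by positivity)] at hi
    linarith
  have hsmall : ∀ᶠ i in atTop, crossRatio ρ a (x i) c d ≤ T := by
    have hε : 0 < T * ρ c d / ρ a c := by positivity
    filter_upwards [eventually_lt_mul_of_le_mul_max hK0 pad hε htop
      (fun i => max_comm (ρ (x i) a) (ρ (x i) d) ▸ hquasi i)] with i hi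
    rw [crossRatio, div_le_iff₀ (mul_pos (pax i) pcd)]
    rw [hρ.2.2.1 (x i) a, div_mul_eq_mul_div, lt_div_iff₀ pac] at hi
    linarith
  obtain ⟨i, hi, hi'⟩ := exists_int_lt_and_succ_le hlarge hsmall
  refine ⟨x (i + 1), (hx _).1.symm, (hx _).2, ?_, hi'⟩
  have hratio : crossRatio ρ a (x i) c d / crossRatio ρ a (x (i + 1)) c d ≤ σ := by
    have hl := (abs_le.1 (hlog i)).2
    rw [hρ.crossRatio_eq_div hac hcd (hx i).1 (hx (i + 1)).1 (hx (i + 1)).2] at hl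
    exact (Real.log_le_log_iff (div_pos (hu _) (hu _)) hσ0).1 hl
  rw [div_le_iff₀ (hu _)] at hratio
  have hTσ : 1 / (2 * σ ^ 2) = T / σ := by
    rw [hT]
    field_simp
  rw [hTσ, div_le_iff₀' hσ0]
  exact hi.le.trans hratio
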